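/- Let m ≥ 2, k = 2m, and let a_1, …, a_k be nonzero integers that admit no canceling partition, i.e., there is no partition of the index set {1,…,2m} into m pairs {i,j} with a_i + a_j = 0. Then for every integer r ≥ 2 the equation a_1x_1 + ⋯ + a_kx_k = 0 is r-uncommon over the integers: there exist δ > 0 and N₀ such that for every n ≥ N₀ there is a coloring c : {1,…,n} → {1,…,r} with r^{k−1} · #{(x_1,…,x_k) ∈ {1,…,n}^k : a_1x_1 + ⋯ + a_kx_k = 0 and c(x_1) = ⋯ = c(x_k)} ≤ (1 − δ) · #{(x_1,…,x_k) ∈ {1,…,n}^k : a_1x_1 + ⋯ + a_kx_k = 0}. -/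

import Mathlib

open Finset in
theorem exists_count_neg_lt_count {k : ℕ} (a : Fin k → ℤ)
    (hnc : ¬ ∃ σ : Equiv.Perm (Fin k),
      (∀ i, σ i ≠ i) ∧ (∀ i, σ (σ i) = i) ∧ (∀ i, a i + a (σ i) = 0))
    (ha : ∀ i, a i ≠ 0) :
    ∃ b : ℤ, b ≠ 0 ∧ #{i | a i = -b} < #{i | a i = b} := by
  by_contra! hcon
  have hcard : ∀ b : ℤ, b ≠ 0 → #{i | a i = b} = #{i | a i = -b} := fun b hb =>
    le_antisymm (hcon b hb) (by simpa using hcon (-b) (neg_ne_zero.2 hb))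
  have hequiv : ∀ b : ℤ, 0 < b → Nonempty ({i // a i = b} ≃ {i // a i = -b}) := fun b hb =>
    Fintype.card_eq.1 (by rw [Fintype.card_subtype, Fintype.card_subtype, hcard b hb.ne'])
  let e : ∀ b : {b : ℤ // 0 < b}, {i // a i = b} ≃ {i // a i = -b} :=
    fun b => (hequiv b b.2).some
  have hneg : ∀ i, ¬ 0 < a i → 0 < -a i := fun i h => by have := ha i; omega
  let f : Fin k → Fin k := fun i =>
    if h : 0 < a i then (e ⟨a i, h⟩ ⟨i, rfl⟩).1
    else ((e ⟨-a i, hneg i h⟩).symm ⟨i, (neg_neg _).symm⟩).1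
  have hpos : ∀ (b : ℤ) (hb : 0 < b) (i) (h : a i = b), f i = (e ⟨b, hb⟩ ⟨i, h⟩).1 := by
    intro b hb i h
    subst h
    simp [f, hb]
  have hnegf : ∀ (b : ℤ) (hb : 0 < b) (i) (h : a i = -b), f i = ((e ⟨b, hb⟩).symm ⟨i, h⟩).1 := by
    intro b hb i h
    obtain rfl : b = -a i := by omega
    have : ¬ 0 < a i := by omega
    simp [f, this]
  have key : ∀ i, a (f i) = -a i ∧ f (f i) = i := by
    intro i
    by_cases h : 0 < a i
    · have h1 := hpos (a i) h i rfl
      have h2 := (e ⟨a i, h⟩ ⟨i, rfl⟩).2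
      rw [← h1] at h2
      refine ⟨h2, ?_⟩
      rw [hnegf (a i) h (f i) h2]
      have : (⟨f i, h2⟩ : {j // a j = -a i}) = e ⟨a i, h⟩ ⟨i, rfl⟩ := Subtype.ext h1
      simp only [this, Equiv.symm_apply_apply]
    · have h1 := hnegf (-a i) (hneg i h) i (neg_neg _).symm
      have h2 := ((e ⟨-a i, hneg i h⟩).symm ⟨i, (neg_neg _).symm⟩).2
      rw [← h1] at h2
      refine ⟨h2, ?_⟩
      rw [hpos (-a i) (hneg i h) (f i) h2]
      have : (⟨f i, h2⟩ : {j // a j = -a i}) =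
        (e ⟨-a i, hneg i h⟩).symm ⟨i, (neg_neg _).symm⟩ := Subtype.ext h1
      simp only [this, Equiv.apply_symm_apply]
  have hinv : Function.Involutive f := fun i => (key i).2
  refine hnc ⟨hinv.toPerm, fun i h => ?_, fun i => hinv i, fun i => ?_⟩
  · have h1 := (key i).1
    rw [show f i = i from h] at h1
    have := ha i
    omega
  · have h1 := (key i).1
    simp [h1]

open Finset in
theorem sum_solutions_prod_eq {N k : ℕ} [NeZero N] (a : Fin k → ZMod N) (W : ZMod N → ℂ) :
    (N : ℂ) * ∑ x : Fin k → ZMod N with ∑ i, a i * x i = 0,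
      ∏ i, ∑ η, W η * ZMod.stdAddChar (η * x i) = (N : ℂ) ^ k * ∑ ξ, ∏ i, W (ξ * a i) := by
  set χ := ZMod.stdAddChar (N := N)
  have hχ : ∀ b : ZMod N, ∑ x, χ (x * b) = if b = 0 then (N : ℂ) else 0 := fun b => by
    simpa using AddChar.sum_mulShift b (ZMod.isPrimitive_stdAddChar N)
  have hsum : ∀ u : Fin k → ZMod N, χ (∑ i, u i) = ∏ i, χ (u i) := fun u =>
    map_prod χ.toMonoidHom (fun i => Multiplicative.ofAdd (u i)) univ
  have hinner : ∀ b, ∑ y, (∑ η, W η * χ (η * y)) * χ (y * -b) = N * W b := by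
    intro b
    simp only [sum_mul]
    rw [sum_comm]
    have : ∀ η, ∑ y, W η * χ (η * y) * χ (y * -b) = if η = b then N * W b else 0 := by
      intro η
      simp_rw [mul_assoc, ← mul_sum, ← AddChar.map_add_eq_mul]
      have h : ∀ y, η * y + y * -b = y * (η - b) := fun y => by ring
      simp_rw [h, hχ, sub_eq_zero]
      split_ifs with h
      · rw [h, mul_comm]
      · simp
    rw [sum_congr rfl fun η _ => this η]
    simp
  calc _ = ∑ x : Fin k → ZMod N, (∑ ξ, χ (ξ * -∑ i, a i * x i)) *
        ∏ i, ∑ η, W η * χ (η * x i) := by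
        rw [mul_sum, sum_filter]
        refine sum_congr rfl fun x _ => ?_
        rw [hχ]
        simp only [neg_eq_zero, ite_mul, zero_mul]
    _ = ∑ ξ, ∑ x : Fin k → ZMod N, ∏ i, ((∑ η, W η * χ (η * x i)) * χ (x i * -(ξ * a i))) := by
        rw [sum_congr rfl fun x _ => sum_mul .., sum_comm]
        refine sum_congr rfl fun ξ _ => sum_congr rfl fun x _ => ?_
        rw [prod_mul_distrib, mul_comm, ← hsum]
        congr 2
        rw [← sum_neg_distrib, mul_sum]
        exact sum_congr rfl fun i _ => by ring
    _ = ∑ ξ, ∏ i, (N * W (ξ * a i)) := by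
        refine sum_congr rfl fun ξ _ => ?_
        rw [← Fintype.piFinset_univ, ← Finset.prod_univ_sum (fun _ => univ)
          (fun i y => (∑ η, W η * χ (η * y)) * χ (y * -(ξ * a i)))]
        exact prod_congr rfl fun i _ => hinner _
    _ = _ := by
        simp_rw [prod_mul_distrib, mul_sum]
        simp

open Finset in
theorem exists_coloring_card_le {X : Type*} [Fintype X] [DecidableEq X] {k r : ℕ} (hk : 0 < k)
    (f : X → Fin r → ℝ) (hf : ∀ x t, 0 ≤ f x t) (hf1 : ∀ x, ∑ t, f x t = 1)
    (P : Finset (Fin k → X)) :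
    ∃ c : X → Fin r, (#{x ∈ P | ∀ i j, c (x i) = c (x j)} : ℝ) ≤
      ∑ x ∈ P, ∑ t, ∏ i, f (x i) t + #{x ∈ P | ¬ Function.Injective x} := by
  classical
  set w : (X → Fin r) → ℝ := fun c => ∏ y, f y (c y)
  have hw : ∀ c, 0 ≤ w c := fun c => prod_nonneg fun y _ => hf y _
  have hw1 : ∑ c, w c = 1 := by
    rw [← Fintype.piFinset_univ, ← prod_univ_sum (fun _ => univ) f]
    simp [hf1]
  have hinj : ∀ x : Fin k → X, Function.Injective x → ∀ t,
      ∑ c, w c * (if ∀ i, c (x i) = t then 1 else 0) = ∏ i, f (x i) t := by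
    intro x hx t
    have h1 : ∀ c : X → Fin r, w c * (if ∀ i, c (x i) = t then 1 else 0) =
        ∏ y, f y (c y) * (if y ∈ univ.image x → c y = t then 1 else 0) := by
      intro c
      rw [prod_mul_distrib, prod_ite_zero]
      simp [w]
    simp_rw [h1]
    rw [← Fintype.piFinset_univ, ← prod_univ_sum (fun _ => univ)
      (fun y s => f y s * (if y ∈ univ.image x → s = t then (1 : ℝ) else 0))]
    have h2 : ∀ y, ∑ s, f y s * (if y ∈ univ.image x → s = t then (1 : ℝ) else 0) =
        if y ∈ univ.image x then f y t else 1 := by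
      intro y
      split_ifs with h
      · simp [h]
      · simp [h, hf1]
    simp_rw [h2]
    rw [prod_ite_mem, univ_inter, prod_image (fun i _ j _ h => hx h)]
  have hmono : ∀ (c : X → Fin r) (x : Fin k → X), (if ∀ i j, c (x i) = c (x j) then (1 : ℝ) else 0)
      = ∑ t, if ∀ i, c (x i) = t then 1 else 0 := by
    intro c x
    split_ifs with h
    · have : ∀ t, (∀ i, c (x i) = t) ↔ c (x ⟨0, hk⟩) = t :=
        fun t => ⟨fun h' => h' _, fun h' i => (h i _).trans h'⟩
      simp [this]
    · refine (sum_eq_zero fun t _ => if_neg fun h' => h fun i j => ?_).symm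
      rw [h', h']
  have havg : ∑ c, w c * (#{x ∈ P | ∀ i j, c (x i) = c (x j)} : ℝ) ≤
      ∑ x ∈ P, ∑ t, ∏ i, f (x i) t + #{x ∈ P | ¬ Function.Injective x} := by
    simp_rw [natCast_card_filter, mul_sum]
    rw [sum_comm, ← sum_add_distrib]
    refine sum_le_sum fun x _ => ?_
    by_cases hx : Function.Injective x
    · simp_rw [hmono, mul_sum]
      rw [sum_comm, sum_congr rfl fun t _ => hinj x hx t]
      simp [hx]
    · have h1 : ∑ c, w c * (if ∀ i j, c (x i) = c (x j) then (1 : ℝ) else 0) ≤ ∑ c, w c :=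
        sum_le_sum fun c _ => mul_le_of_le_one_right (hw c) (by split_ifs <;> norm_num)
      have h2 : 0 ≤ ∑ t, ∏ i, f (x i) t := sum_nonneg fun t _ => prod_nonneg fun i _ => hf _ _
      simp only [hx, not_false_eq_true, if_true]
      linarith
  by_contra! hcon
  set R := ∑ x ∈ P, ∑ t, ∏ i, f (x i) t + (#{x ∈ P | ¬ Function.Injective x} : ℝ)
  have hpos : ∃ c, 0 < w c := by
    by_contra! h
    have := sum_nonpos fun c (_ : c ∈ univ) => h c
    linarith
  obtain ⟨c₀, hc₀⟩ := hpos
  have : ∑ c, w c * R < ∑ c, w c * (#{x ∈ P | ∀ i j, c (x i) = c (x j)} : ℝ) :=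
    sum_lt_sum (fun c _ => mul_le_mul_of_nonneg_left (hcon c).le (hw c))
      ⟨c₀, mem_univ _, mul_lt_mul_of_pos_left (hcon c₀) hc₀⟩
  rw [← sum_mul, hw1] at this
  linarith

theorem eq_of_intCast_zmod_eq {p : ℕ} {x y : ℤ} (h : (x : ZMod p) = y) (hlt : |x - y| < p) :
    x = y := by
  have := (ZMod.intCast_eq_intCast_iff_dvd_sub y x p).1 h.symm
  have := Int.eq_zero_of_abs_lt_dvd this hlt
  omega

theorem eq_one_or_neg_one_of_mul_mem {p k : ℕ} [Fact p.Prime] (hk : 0 < k) {a : Fin k → ℤ}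
    (ha : ∀ i, a i ≠ 0) {M : ℕ} (hM : ∀ i, |a i| ≤ M) (hp : 2 * M ^ 2 < p) {ξ : ZMod p}
    (h : ∀ i, ∃ j, ξ * a i = a j ∨ ξ * a i = -a j) : ξ = 1 ∨ ξ = -1 := by
  have : Nonempty (Fin k) := ⟨⟨0, hk⟩⟩
  obtain ⟨i, hi⟩ := Finite.exists_max fun i => |a i|
  obtain ⟨l, hl⟩ := Finite.exists_min fun i => |a i|
  have h' : ∀ j, ∃ s : ℤ, ξ * a j = s ∧ ∃ t, |s| = |a t| := by
    intro j
    obtain ⟨t, ht | ht⟩ := h j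
    · exact ⟨a t, ht, t, rfl⟩
    · exact ⟨-a t, by simpa using ht, t, abs_neg _⟩
  have hpZ : 2 * (M : ℤ) ^ 2 < p := by exact_mod_cast hp
  have hM1 : 1 ≤ (M : ℤ) := le_trans (Int.one_le_abs (ha i)) (hM i)
  have hne : ((a i : ℤ) : ZMod p) ≠ 0 := by
    intro h0
    refine ha i (eq_of_intCast_zmod_eq (p := p) (by simpa using h0) ?_)
    have := hM i
    rw [sub_zero]
    nlinarith
  obtain ⟨s, hs, t, hst⟩ := h' i
  obtain ⟨u, hu, v, huv⟩ := h' l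
  have hcross : a i * u = s * a l := by
    refine eq_of_intCast_zmod_eq (p := p) ?_ ?_
    · push_cast
      rw [← hu, ← hs]
      ring
    · have h1 : |a i * u| ≤ M * M := by
        rw [abs_mul, huv]
        exact mul_le_mul (hM _) (hM _) (abs_nonneg _) (by positivity)
      have h2 : |s * a l| ≤ M * M := by
        rw [abs_mul, hst]
        exact mul_le_mul (hM _) (hM _) (abs_nonneg _) (by positivity)
      have := abs_sub (a i * u) (s * a l)
      nlinarith
  have habs : |s| = |a i| := by
    have h1 : |a i| * |u| = |s| * |a l| := by rw [← abs_mul, hcross, abs_mul]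
    have h2 : |a l| ≤ |u| := huv ▸ hl v
    have h3 : |s| ≤ |a i| := hst ▸ hi t
    have h4 : 0 < |a l| := abs_pos.2 (ha l)
    nlinarith [abs_nonneg (a i)]
  rcases abs_eq_abs.1 habs with rfl | rfl
  · exact Or.inl (mul_right_cancel₀ hne (by rw [hs, one_mul]))
  · exact Or.inr (mul_right_cancel₀ hne (by rw [hs]; push_cast; ring))

open Finset ComplexConjugate in
theorem exists_fourier_weight {p k : ℕ} [Fact p.Prime] (hk : 0 < k) {a : Fin k → ℤ}
    (ha : ∀ i, a i ≠ 0) {M : ℕ} (hM : ∀ i, |a i| ≤ M) (hp : 2 * M ^ 2 < p) {b : ℤ} (hb0 : b ≠ 0)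
    (hb : #{i | a i = -b} < #{i | a i = b}) :
    ∃ W : ZMod p → ℂ, W 0 = 0 ∧ (∀ η, W (-η) = conj (W η)) ∧ ∑ η, ‖W η‖ ≤ 2 * k ∧
      ∑ ξ, ∏ i, W (ξ * a i) = -2 := by
  have hpZ : 2 * (M : ℤ) ^ 2 < p := by exact_mod_cast hp
  have hM1 : 1 ≤ (M : ℤ) := le_trans (Int.one_le_abs (ha ⟨0, hk⟩)) (hM _)
  have hcast : ∀ x y : ℤ, |x| ≤ M → |y| ≤ M → (x : ZMod p) = y → x = y := by
    intro x y hx hy h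
    refine eq_of_intCast_zmod_eq h ?_
    have := abs_sub x y
    nlinarith
  obtain ⟨i₀, hi₀⟩ := card_pos.1 (lt_of_le_of_lt (Nat.zero_le _) hb)
  have hi₀ : a i₀ = b := by simpa using hi₀
  have hbM : |b| ≤ M := hi₀ ▸ hM i₀
  have hbM' : |-b| ≤ M := by rwa [abs_neg]
  set d := #{i | a i = b} - #{i | a i = -b} with hd
  have hd0 : (d : ℂ) ≠ 0 := by
    have : d ≠ 0 := by omega
    exact_mod_cast this
  set ω : ℂ := Complex.exp ((Real.pi / d : ℝ) * Complex.I) with hω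
  have hωd : ω ^ d = -1 := by
    rw [hω, ← Complex.exp_nat_mul, ← Complex.exp_pi_mul_I]
    congr 1
    push_cast
    field_simp
  have hωn : ‖ω‖ = 1 := Complex.norm_exp_ofReal_mul_I _
  have hωc : ω * conj ω = 1 := by
    rw [Complex.mul_conj, Complex.normSq_eq_norm_sq, hωn]
    norm_num
  set S : Finset (ZMod p) := univ.image (fun i => (a i : ZMod p)) ∪
    univ.image (fun i => -(a i : ZMod p)) with hS
  have hSmem : ∀ η, η ∈ S ↔ ∃ j, η = a j ∨ η = -a j := by
    intro η
    simp only [hS, mem_union, mem_image, mem_univ, true_and, exists_or, eq_comm]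
  have hSneg : ∀ η, -η ∈ S ↔ η ∈ S := by
    intro η
    simp only [hSmem, neg_eq_iff_eq_neg, neg_neg]
    exact exists_congr fun j => or_comm
  have hbb : (b : ZMod p) ≠ -b := fun h => by
    have := hcast b (-b) hbM hbM' (by simpa using h)
    omega
  have ha0 : ∀ i, (a i : ZMod p) ≠ 0 := fun i h =>
    ha i (hcast _ 0 (hM i) (by simp) (by simpa using h))
  set V : ZMod p → ℂ := fun η => if η = b then ω else if η = -b then conj ω else 1 with hV
  have hVneg : ∀ η, V (-η) = conj (V η) := by
    intro η
    simp only [hV, neg_eq_iff_eq_neg, neg_neg]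
    by_cases h1 : η = b
    · simp [h1, hbb]
    · by_cases h2 : η = -b
      · simp [h2, hbb.symm]
      · simp [h1, h2]
  have hVn : ∀ η, ‖V η‖ = 1 := by
    intro η
    simp only [hV]
    split_ifs <;> simp [hωn]
  set W : ZMod p → ℂ := fun η => if η ∈ S then V η else 0 with hW
  have hWneg : ∀ η, W (-η) = conj (W η) := by
    intro η
    simp only [hW, hSneg, hVneg]
    split_ifs <;> simp
  have hWa : ∏ i, W (a i) = -1 := by
    have h1 : ∀ i, W (a i) = (if a i = b then ω else 1) * (if a i = -b then conj ω else 1) := by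
      intro i
      have hmem : (a i : ZMod p) ∈ S := (hSmem _).2 ⟨i, Or.inl rfl⟩
      have e1 : (a i : ZMod p) = b ↔ a i = b :=
        ⟨hcast _ _ (hM i) hbM, fun h => by rw [h]⟩
      have e2 : (a i : ZMod p) = -b ↔ a i = -b :=
        ⟨fun h => hcast _ _ (hM i) hbM' (by simpa using h), fun h => by rw [h]; simp⟩
      simp only [hW, hmem, if_true, hV, e1, e2]
      by_cases h : a i = b
      · have : a i ≠ -b := by omega
        rw [if_pos h, if_pos h, if_neg this, mul_one]
      · rw [if_neg h, if_neg h, one_mul]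
    simp_rw [h1, prod_mul_distrib, prod_ite, prod_const_one, prod_const, mul_one]
    rw [← Nat.sub_add_cancel hb.le, pow_add, mul_assoc, ← mul_pow, hωc, one_pow, mul_one, ← hd, hωd]
  refine ⟨W, ?_, hWneg, ?_, ?_⟩
  · refine if_neg fun h => ?_
    obtain ⟨j, hj | hj⟩ := (hSmem _).1 h
    · exact ha0 j hj.symm
    · exact ha0 j (by simpa using hj.symm)
  · calc ∑ η, ‖W η‖ = ∑ η, if η ∈ S then 1 else 0 := by
          refine sum_congr rfl fun η _ => ?_
          simp only [hW]
          split_ifs <;> simp [hVn]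
      _ = (#S : ℝ) := by simp
      _ ≤ ((k + k : ℕ) : ℝ) := by
          refine Nat.cast_le.2 ((card_union_le _ _).trans (add_le_add ?_ ?_)) <;>
          exact card_image_le.trans (by simp)
      _ = 2 * k := by push_cast; ring
  · have h11 : (1 : ZMod p) ≠ -1 := by
      intro h
      have := hcast 1 (-1) (by simpa using hM1) (by simpa using hM1) (by simpa using h)
      omega
    rw [← sum_subset (subset_univ ({1, -1} : Finset (ZMod p))), sum_pair h11]
    · have : ∏ i, W (-1 * a i) = conj (∏ i, W (a i)) := by
        rw [map_prod]
        exact prod_congr rfl fun i _ => by rw [neg_one_mul, hWneg]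
      rw [this]
      simp only [one_mul, hWa]
      simp
      norm_num
    · intro ξ _ hξ
      by_contra hne
      refine hξ ?_
      rw [mem_insert, mem_singleton]
      refine eq_one_or_neg_one_of_mul_mem hk ha hM hp fun i => (hSmem _).1 ?_
      by_contra hmem
      exact hne (prod_eq_zero (mem_univ i) (if_neg hmem))

open Finset in
theorem card_not_injective_solutions_le {p k : ℕ} [Fact p.Prime] (hk : 3 ≤ k) {a : Fin k → ZMod p}
    (ha : ∀ i, a i ≠ 0) :
    #{x : Fin k → ZMod p | (∑ i, a i * x i = 0) ∧ ¬ Function.Injective x} ≤ k * k * p ^ (k - 2) := by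
  have hsub : ({x : Fin k → ZMod p | (∑ i, a i * x i = 0) ∧ ¬ Function.Injective x} : Finset _) ⊆
      (univ ×ˢ univ : Finset (Fin k × Fin k)).biUnion fun q =>
        {x | (∑ i, a i * x i = 0) ∧ q.1 ≠ q.2 ∧ x q.1 = x q.2} := by
    intro x hx
    simp only [mem_filter, mem_univ, true_and, Function.Injective, not_forall] at hx
    obtain ⟨h, i, j, hij, hne⟩ := hx
    simp only [mem_biUnion, mem_filter, mem_univ, true_and]
    exact ⟨(i, j), by simp, h, hne, hij⟩
  refine (card_le_card hsub).trans ((card_biUnion_le_card_mul _ _ (p ^ (k - 2)) ?_).trans ?_)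
  · rintro ⟨i, j⟩ -
    by_cases hij : i = j
    · simp [hij]
    obtain ⟨l, hl⟩ : ∃ l, l ∉ ({i, j} : Finset (Fin k)) := by
      by_contra! h
      have h1 := card_le_card (fun l _ => h l : (univ : Finset (Fin k)) ⊆ {i, j})
      have h2 := card_le_two (a := i) (b := j)
      simp at h1
      omega
    simp only [mem_insert, mem_singleton, not_or] at hl
    have hinj : Set.InjOn (fun (x : Fin k → ZMod p) (t : {t // t ≠ j ∧ t ≠ l}) => x t)
        ({x | (∑ i, a i * x i = 0) ∧ i ≠ j ∧ x i = x j} : Finset (Fin k → ZMod p)) := by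
      intro x hx y hy hxy
      simp only [coe_filter, mem_univ, true_and, Set.mem_ofPred_eq] at hx hy
      have h1 : ∀ t, t ≠ l → x t = y t := by
        intro t htl
        by_cases htj : t = j
        · rw [htj, ← hx.2.2, ← hy.2.2]
          exact congrFun hxy ⟨i, hij, Ne.symm hl.1⟩
        · exact congrFun hxy ⟨t, htj, htl⟩
      have h2 : ∑ t, a t * (x t - y t) = 0 := by
        simp_rw [mul_sub, sum_sub_distrib, hx.1, hy.1, sub_zero]
      rw [sum_eq_single l (fun t _ ht => by rw [h1 t ht, sub_self, mul_zero]) (by simp)] at h2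
      funext t
      by_cases ht : t = l
      · rw [ht]
        exact sub_eq_zero.1 ((mul_eq_zero.1 h2).resolve_left (ha l))
      · exact h1 t ht
    refine (card_le_card_of_injOn (t := univ) _ (fun _ _ => mem_coe.2 (mem_univ _)) hinj).trans ?_
    rw [card_univ, Fintype.card_fun, ZMod.card]
    refine le_of_eq (congrArg _ ?_)
    rw [Fintype.card_subtype]
    have : ({t | t ≠ j ∧ t ≠ l} : Finset (Fin k)) = univ \ {j, l} := by ext; simp
    rw [this, card_sdiff_of_subset (subset_univ _), card_pair (Ne.symm hl.2)]
    simp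
  · simp

open Finset ComplexConjugate in
theorem exists_real_function_of_fourier_weight {p k : ℕ} [Fact p.Prime] {a : Fin k → ZMod p}
    (ha : ∀ i, a i ≠ 0) (hk : 0 < k) {W : ZMod p → ℂ} (hW0 : W 0 = 0) (hWneg : ∀ η, W (-η) = conj (W η))
    {C : ℝ} (hC : ∑ η, ‖W η‖ ≤ C) {A : ℝ} (hA : ∑ ξ, ∏ i, W (ξ * a i) = A) :
    ∃ g : ZMod p → ℝ, (∀ x, |g x| ≤ C) ∧ ∀ s ε : ℝ,
      ∑ x : Fin k → ZMod p with ∑ i, a i * x i = 0, ∏ i, (s + ε * g (x i)) =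
        (p : ℝ) ^ (k - 1) * (s ^ k + ε ^ k * A) := by
  set G : ZMod p → ℂ := fun x => ∑ η, W η * ZMod.stdAddChar (η * x) with hG
  have hGre : ∀ x, ((G x).re : ℂ) = G x := by
    intro x
    rw [← Complex.conj_eq_iff_re, hG, map_sum]
    refine Fintype.sum_equiv (Equiv.neg _) _ _ fun η => ?_
    rw [map_mul, ← hWneg, Equiv.neg_apply, neg_mul, AddChar.map_neg_eq_conj]
  have hp0 : (p : ℝ) ≠ 0 := by exact_mod_cast (Fact.out : p.Prime).ne_zero
  refine ⟨fun x => (G x).re, fun x => ?_, fun s ε => ?_⟩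
  · refine (Complex.abs_re_le_norm _).trans ((norm_sum_le _ _).trans (le_trans (le_of_eq ?_) hC))
    refine sum_congr rfl fun η _ => ?_
    rw [norm_mul, AddChar.norm_apply, mul_one]
  · set U : ZMod p → ℂ := fun η => (if η = 0 then (s : ℂ) else 0) + ε * W η with hU
    have hUsum : ∀ x, ∑ η, U η * ZMod.stdAddChar (η * x) = ((s + ε * (G x).re : ℝ) : ℂ) := by
      intro x
      simp only [hU, add_mul, sum_add_distrib, ite_mul, zero_mul]
      push_cast
      rw [hGre, hG, mul_sum]
      simp [mul_assoc]
    have hprod : ∀ ξ, ∏ i, U (ξ * a i) =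
        (if ξ = 0 then (s : ℂ) ^ k else 0) + ε ^ k * ∏ i, W (ξ * a i) := by
      intro ξ
      by_cases h : ξ = 0
      · simp [h, hU, hW0, hk.ne']
      · simp [h, hU, ha, prod_mul_distrib]
    have key := sum_solutions_prod_eq a U
    simp_rw [hUsum, hprod, sum_add_distrib, ← mul_sum, hA] at key
    have key' : (p : ℝ) * ∑ x : Fin k → ZMod p with ∑ i, a i * x i = 0,
        ∏ i, (s + ε * (G (x i)).re) = (p : ℝ) ^ k * (s ^ k + ε ^ k * A) := by
      have h2 : (∑ ξ : ZMod p, if ξ = 0 then (s : ℂ) ^ k else 0) = s ^ k := by simp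
      rw [h2] at key
      exact_mod_cast key
    refine mul_left_cancel₀ hp0 (key'.trans ?_)
    rw [← mul_assoc, ← pow_succ', Nat.sub_add_cancel hk]

open Finset in
theorem exists_prime_coloring {k : ℕ} (hk : 3 ≤ k) (hke : Even k) {a : Fin k → ℤ}
    (ha : ∀ i, a i ≠ 0)
    (hnc : ¬ ∃ σ : Equiv.Perm (Fin k),
      (∀ i, σ i ≠ i) ∧ (∀ i, σ (σ i) = i) ∧ (∀ i, a i + a (σ i) = 0))
    {r : ℕ} (hr : 2 ≤ r) :
    ∃ p : ℕ, p.Prime ∧ (∀ i, (a i : ZMod p) ≠ 0) ∧ ∃ _ : NeZero p, ∃ c : ZMod p → Fin r,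
      r ^ (k - 1) * #{x : Fin k → ZMod p | (∑ i, (a i : ZMod p) * x i = 0) ∧
        ∀ i j, c (x i) = c (x j)} < #{x : Fin k → ZMod p | ∑ i, (a i : ZMod p) * x i = 0} := by
  obtain ⟨b, hb0, hb⟩ := exists_count_neg_lt_count a hnc ha
  have hk0 : 0 < k := by omega
  set M : ℕ := ∑ i, (a i).natAbs with hMdef
  have hM : ∀ i, |a i| ≤ M := by
    intro i
    rw [Int.abs_eq_natAbs]
    exact_mod_cast single_le_sum (f := fun i => (a i).natAbs) (fun _ _ => Nat.zero_le _) (mem_univ i)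
  have hr0 : (0 : ℝ) < r := by exact_mod_cast (by omega : 0 < r)
  have hkr : (0 : ℝ) < k := by exact_mod_cast hk0
  set ε : ℝ := 1 / (2 * k * r) with hε
  have hε0 : 0 < ε := by positivity
  obtain ⟨L, hL⟩ := exists_nat_gt ((k : ℝ) * k / (4 * ε ^ k))
  obtain ⟨p, hpL, hp⟩ := Nat.exists_infinite_primes (2 * M ^ 2 + 1 + L)
  have hpM : 2 * M ^ 2 < p := by omega
  have hpbig : (k : ℝ) * k < 4 * ε ^ k * p := by
    have h1 : (L : ℝ) ≤ p := by exact_mod_cast (by omega : L ≤ p)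
    have := (div_lt_iff₀ (by positivity)).1 (hL.trans_le h1)
    linarith
  have : Fact p.Prime := ⟨hp⟩
  have ha' : ∀ i, (a i : ZMod p) ≠ 0 := by
    intro i h
    refine ha i (eq_of_intCast_zmod_eq (p := p) (by simpa using h) ?_)
    have h1 := hM i
    have h2 := Int.one_le_abs (ha i)
    have : 2 * (M : ℤ) ^ 2 < p := by exact_mod_cast hpM
    rw [sub_zero]
    nlinarith
  refine ⟨p, hp, ha', inferInstance, ?_⟩
  obtain ⟨W, hW0, hWneg, hWn, hWs⟩ := exists_fourier_weight hk0 ha hM hpM hb0 hb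
  obtain ⟨g, hg, hsum⟩ := exists_real_function_of_fourier_weight (a := fun i => (a i : ZMod p))
    ha' hk0 hW0 hWneg hWn (A := -2) (by exact_mod_cast hWs)
  obtain ⟨q, rfl⟩ : ∃ q, r = q + 2 := ⟨r - 2, by omega⟩
  set s : Fin (q + 2) → ℝ := Fin.cons ε (Fin.cons (-ε) fun _ => 0) with hs
  have hs1 : ∑ t, s t = 0 := by simp [hs, Fin.sum_univ_succ]
  have hs2 : ∑ t, s t ^ k = 2 * ε ^ k := by
    simp [hs, Fin.sum_univ_succ, hke.neg_pow, hk0.ne']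
    ring
  have hsabs : ∀ t, |s t| ≤ ε := by
    intro t
    refine Fin.cases ?_ (fun t => Fin.cases ?_ (fun t => ?_) t) t <;> simp [hs, abs_of_pos hε0, hε0.le]
  obtain ⟨c, hc⟩ := exists_coloring_card_le hk0
    (fun y t => 1 / ((q + 2 : ℕ) : ℝ) + s t * g y) (fun y t => by
      have h1 : |s t * g y| ≤ ε * (2 * k) := by
        rw [abs_mul]
        exact mul_le_mul (hsabs t) (hg y) (abs_nonneg _) hε0.le
      have h2 : ε * (2 * k) = 1 / ((q + 2 : ℕ) : ℝ) := by
        rw [hε]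
        field_simp
      linarith [neg_abs_le (s t * g y)])
    (fun y => by
      rw [sum_add_distrib, ← sum_mul, hs1]
      simp
      field_simp)
    ({x : Fin k → ZMod p | ∑ i, (a i : ZMod p) * x i = 0} : Finset _)
  refine ⟨c, ?_⟩
  have hbad := card_not_injective_solutions_le hk ha'
  rw [sum_comm] at hc
  simp_rw [hsum, ← mul_sum, sum_add_distrib, ← sum_mul, hs2] at hc
  rw [filter_filter, filter_filter] at hc
  have htot : (#{x : Fin k → ZMod p | ∑ i, (a i : ZMod p) * x i = 0} : ℝ) = (p : ℝ) ^ (k - 1) := by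
    simpa using hsum 1 0 |>.trans (by simp [hk0.ne'])
  have hppos : (0 : ℝ) < p := by exact_mod_cast hp.pos
  set R : ℝ := ((q + 2 : ℕ) : ℝ) with hR
  have hR1 : R ^ (k - 1) * (R * (1 / R) ^ k) = 1 := by
    rw [← mul_assoc, ← pow_succ, Nat.sub_add_cancel hk0, ← mul_pow]
    field_simp
    simp
  have hbad' : (#{x : Fin k → ZMod p | (∑ i, (a i : ZMod p) * x i = 0) ∧
      ¬ Function.Injective x} : ℝ) < 4 * ε ^ k * p ^ (k - 1) := by
    calc _ ≤ (k : ℝ) * k * p ^ (k - 2) := by exact_mod_cast hbad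
      _ < 4 * ε ^ k * p * p ^ (k - 2) := mul_lt_mul_of_pos_right hpbig (by positivity)
      _ = _ := by
        rw [mul_assoc, ← pow_succ', show k - 2 + 1 = k - 1 by omega]
  have hlt : (#{x : Fin k → ZMod p | (∑ i, (a i : ZMod p) * x i = 0) ∧
      ∀ i j, c (x i) = c (x j)} : ℝ) < p ^ (k - 1) * (R * (1 / R) ^ k) := by
    refine hc.trans_lt ?_
    rw [sum_const, card_univ, Fintype.card_fin, nsmul_eq_mul, ← hR]
    linarith
  have hfin := mul_lt_mul_of_pos_left hlt (by positivity : 0 < R ^ (k - 1))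
  rw [mul_left_comm, hR1, mul_one, ← htot, hR] at hfin
  exact_mod_cast hfin

/-- The solutions of `∑ i, a i * x i = 0` with all entries in `{1, …, n}`. -/
noncomputable def boxSolutions {k : ℕ} (a : Fin k → ℤ) (n : ℕ) : Finset (Fin k → ℤ) :=
  (Fintype.piFinset fun _ : Fin k => Finset.Icc (1 : ℤ) n).filter fun x => ∑ i, a i * x i = 0

theorem mem_boxSolutions {k : ℕ} {a : Fin k → ℤ} {n : ℕ} {x : Fin k → ℤ} :
    x ∈ boxSolutions a n ↔ (∀ i, 1 ≤ x i ∧ x i ≤ n) ∧ ∑ i, a i * x i = 0 := by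
  simp [boxSolutions]

open Finset in
theorem card_boxSolutions_filter_mem_le {k : ℕ} (hk : 2 ≤ k) {a : Fin k → ℤ} (ha : ∀ i, a i ≠ 0)
    (n : ℕ) (i : Fin k) (D : Finset ℤ) :
    #{x ∈ boxSolutions a n | x i ∈ D} ≤ #D * n ^ (k - 2) := by
  have : Nontrivial (Fin k) := Fin.nontrivial_iff_two_le.2 hk
  obtain ⟨l, hl⟩ := exists_ne i
  have hinj : Set.InjOn (fun x : Fin k → ℤ => Function.update x l 0)
      ({x ∈ boxSolutions a n | x i ∈ D} : Finset _) := by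
    intro x hx y hy hxy
    simp only [coe_filter, Set.mem_ofPred_eq, mem_boxSolutions] at hx hy
    have h1 : ∀ t, t ≠ l → x t = y t := by
      intro t ht
      simpa [ht] using congrFun hxy t
    have h2 : ∑ t, a t * (x t - y t) = 0 := by
      simp_rw [mul_sub, sum_sub_distrib, hx.1.2, hy.1.2, sub_zero]
    rw [sum_eq_single l (fun t _ ht => by rw [h1 t ht, sub_self, mul_zero]) (by simp)] at h2
    funext t
    by_cases ht : t = l
    · rw [ht]
      exact sub_eq_zero.1 ((mul_eq_zero.1 h2).resolve_left (ha l))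
    · exact h1 t ht
  refine (card_le_card_of_injOn (t := Fintype.piFinset fun t =>
    if t = l then {0} else if t = i then D else Icc (1 : ℤ) n) _ ?_ hinj).trans ?_
  · intro x hx
    simp only [coe_filter, Set.mem_ofPred_eq, mem_boxSolutions] at hx
    simp only [mem_coe, Fintype.mem_piFinset]
    intro t
    by_cases ht : t = l
    · subst ht
      simp
    · by_cases hti : t = i
      · subst hti
        simp [ht, hx.2]
      · simp [ht, hti, hx.1.1 t]
  · rw [Fintype.card_piFinset, ← mul_prod_erase univ _ (mem_univ l),
      ← mul_prod_erase (univ.erase l) _ (mem_erase.2 ⟨hl.symm, mem_univ i⟩),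
      prod_congr rfl (g := fun _ => n), prod_const, card_erase_of_mem, card_erase_of_mem]
    · simp [hl.symm, Nat.sub_sub]
    · simp
    · simp [hl.symm]
    · intro t ht
      simp only [mem_erase, mem_univ, and_true] at ht
      simp [ht.1, ht.2]

open Finset in
theorem exists_pow_le_card_boxSolutions {d : ℕ} {a : Fin (d + 1) → ℤ} (ha : a 0 ≠ 0)
    {x₀ : Fin (d + 1) → ℤ} (hpos : ∀ i, 0 < x₀ i) (hx₀ : ∑ i, a i * x₀ i = 0) :
    ∃ C : ℕ, 0 < C ∧ ∀ q n : ℕ, C * (q + 1) ≤ n → q ^ d ≤ #(boxSolutions a n) := by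
  set D : ℕ := ∑ i, (a i).natAbs with hD
  set M : ℕ := ∑ i, (x₀ i).natAbs with hM
  have hxM : ∀ i, x₀ i ≤ M := by
    intro i
    refine (le_abs_self _).trans ?_
    rw [Int.abs_eq_natAbs]
    exact_mod_cast single_le_sum (f := fun i => (x₀ i).natAbs) (fun _ _ => Nat.zero_le _)
      (mem_univ i)
  refine ⟨(D + 1) * (M + 1), by positivity, fun q n hn => ?_⟩
  have hnZ : ((D : ℤ) + 1) * (M + 1) * (q + 1) ≤ n := by exact_mod_cast hn
  set y : (Fin d → Fin q) → Fin (d + 1) → ℤ := fun z =>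
    Fin.cons (-∑ i, a (Fin.succ i) * (z i : ℕ)) fun i => a 0 * (z i : ℕ) with hy
  have hz : ∀ (z : Fin d → Fin q) (b : ℤ) i, |b * (z i : ℕ)| ≤ |b| * q := by
    intro z b i
    rw [abs_mul, Nat.abs_cast]
    exact mul_le_mul_of_nonneg_left (by exact_mod_cast (z i).2.le) (abs_nonneg _)
  have hDZ : (D : ℤ) = |a 0| + ∑ i : Fin d, |a i.succ| := by
    rw [hD, Fin.sum_univ_succ]
    push_cast
    rfl
  have hyabs : ∀ z i, |y z i| ≤ D * q := by
    intro z i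
    refine Fin.cases ?_ (fun i => ?_) i
    · simp only [hy, Fin.cons_zero, abs_neg]
      calc |∑ i, a (Fin.succ i) * (z i : ℕ)| ≤ ∑ i, |a (Fin.succ i)| * q :=
            (abs_sum_le_sum_abs _ _).trans (sum_le_sum fun i _ => hz z _ i)
        _ = (∑ i, |a (Fin.succ i)|) * q := by rw [sum_mul]
        _ ≤ D * q := by
          refine mul_le_mul_of_nonneg_right ?_ (by positivity)
          rw [hDZ]
          linarith [abs_nonneg (a 0)]
    · simp only [hy, Fin.cons_succ]
      refine (hz z _ i).trans (mul_le_mul_of_nonneg_right ?_ (by positivity))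
      rw [hDZ]
      linarith [sum_nonneg fun (i : Fin d) (_ : i ∈ univ) => abs_nonneg (a i.succ)]
  have hysum : ∀ z, ∑ i, a i * y z i = 0 := by
    intro z
    simp only [hy, Fin.sum_univ_succ, Fin.cons_zero, Fin.cons_succ, mul_neg, mul_sum]
    rw [neg_add_eq_zero]
    exact sum_congr rfl fun i _ => by ring
  have hcard : q ^ d = #(univ : Finset (Fin d → Fin q)) := by simp
  rw [hcard]
  refine card_le_card_of_injOn (fun z i => (D * q + 1) * x₀ i + y z i) ?_ ?_
  · intro z _
    rw [mem_coe, mem_boxSolutions]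
    refine ⟨fun i => ?_, ?_⟩
    · have h1 := abs_le.1 (hyabs z i)
      have h2 := hpos i
      have h3 := hxM i
      have h4 : (0 : ℤ) ≤ D * q := by positivity
      constructor
      · nlinarith
      · have : (D * q + 1) * x₀ i ≤ (D * q + 1) * M := mul_le_mul_of_nonneg_left h3 (by positivity)
        have h5 : (0 : ℤ) ≤ D * M := by positivity
        have h6 : (0 : ℤ) ≤ M * q := by positivity
        nlinarith
    · simp_rw [mul_add, sum_add_distrib, hysum, mul_left_comm (a _), ← mul_sum, hx₀]
      simp
  · intro z _ w _ h
    funext i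
    have h1 : y z i.succ = y w i.succ := by simpa using congrFun h i.succ
    simp only [hy, Fin.cons_succ] at h1
    exact Fin.ext (by exact_mod_cast mul_left_cancel₀ ha h1)

theorem exists_intCast_eq_of_sum_eq_zero {p d : ℕ} [Fact p.Prime] {a : Fin (d + 1) → ℤ}
    (ha : (a 0 : ZMod p) ≠ 0) {v : Fin (d + 1) → ZMod p} (hv : ∑ i, (a i : ZMod p) * v i = 0) :
    ∃ y : Fin (d + 1) → ℤ, (∀ i, (y i : ZMod p) = v i) ∧ ∑ i, a i * y i = 0 := by
  obtain ⟨b, hb⟩ := ZMod.intCast_surjective ((a 0 : ZMod p)⁻¹)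
  choose w hw using fun i => ZMod.intCast_surjective (v i)
  refine ⟨Fin.cons (-∑ i : Fin d, a i.succ * (b * w i.succ)) fun i => a 0 * (b * w i.succ), ?_, ?_⟩
  · intro i
    refine Fin.cases ?_ (fun i => ?_) i
    · rw [Fin.sum_univ_succ] at hv
      simp only [Fin.cons_zero]
      push_cast
      simp_rw [hb, hw, mul_left_comm _ (a 0 : ZMod p)⁻¹, ← Finset.mul_sum]
      rw [← mul_neg, ← eq_neg_of_add_eq_zero_left hv, inv_mul_cancel_left₀ ha]
    · simp only [Fin.cons_succ]
      push_cast
      rw [hb, hw, mul_inv_cancel_left₀ ha]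
  · simp only [Fin.sum_univ_succ, Fin.cons_zero, Fin.cons_succ, mul_neg, Finset.mul_sum]
    rw [neg_add_eq_zero]
    exact Finset.sum_congr rfl fun i _ => by ring

open Finset in
theorem exists_card_residue_le {p d : ℕ} [Fact p.Prime] (hd : 1 ≤ d) {a : Fin (d + 1) → ℤ}
    (ha : ∀ i, a i ≠ 0) (hap : (a 0 : ZMod p) ≠ 0) :
    ∃ B : ℕ, ∀ v w : Fin (d + 1) → ZMod p, ∑ i, (a i : ZMod p) * v i = 0 →
      ∑ i, (a i : ZMod p) * w i = 0 → ∀ n : ℕ,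
      #{x ∈ boxSolutions a n | (fun i => (x i : ZMod p)) = v} ≤
        #{x ∈ boxSolutions a n | (fun i => (x i : ZMod p)) = w} + B * n ^ (d - 1) := by
  have hlift : ∀ v : Fin (d + 1) → ZMod p, ∃ y : Fin (d + 1) → ℤ,
      ∑ i, (a i : ZMod p) * v i = 0 → (∀ i, (y i : ZMod p) = v i) ∧ ∑ i, a i * y i = 0 := by
    intro v
    by_cases hv : ∑ i, (a i : ZMod p) * v i = 0
    · obtain ⟨y, hy⟩ := exists_intCast_eq_of_sum_eq_zero hap hv
      exact ⟨y, fun _ => hy⟩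
    · exact ⟨0, fun h => absurd h hv⟩
  choose y hy using hlift
  set Y : ℕ := ∑ v, ∑ i, (y v i).natAbs with hYdef
  have hY : ∀ v i, |y v i| ≤ Y := by
    intro v i
    rw [Int.abs_eq_natAbs]
    exact_mod_cast (single_le_sum (f := fun i => (y v i).natAbs) (fun _ _ => Nat.zero_le _)
      (mem_univ i)).trans (single_le_sum (f := fun v => ∑ i, (y v i).natAbs)
        (fun _ _ => Nat.zero_le _) (mem_univ v))
  refine ⟨(d + 1) * (2 * Y), fun v w hv hw n => ?_⟩
  set D : Finset ℤ := Icc 1 (Y : ℤ) ∪ Icc (n - Y + 1 : ℤ) n with hD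
  have hDcard : #D ≤ 2 * Y := by
    refine (card_union_le _ _).trans ?_
    simp only [Int.card_Icc]
    omega
  have hwv : ∑ i, (a i : ZMod p) * (w - v) i = 0 := by
    simp_rw [Pi.sub_apply, mul_sub, sum_sub_distrib, hv, hw, sub_zero]
  obtain ⟨hy1, hy2⟩ := hy _ hwv
  have hsub : {x ∈ boxSolutions a n | (fun i => (x i : ZMod p)) = v} ⊆
      {x ∈ boxSolutions a n | (fun i => (x i : ZMod p)) = v ∧ ∀ i, x i ∉ D} ∪
        univ.biUnion fun i => {x ∈ boxSolutions a n | x i ∈ D} := by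
    intro x hx
    rw [mem_filter] at hx
    by_cases h : ∀ i, x i ∉ D
    · exact mem_union_left _ (mem_filter.2 ⟨hx.1, hx.2, h⟩)
    · push Not at h
      obtain ⟨i, hi⟩ := h
      exact mem_union_right _ (mem_biUnion.2 ⟨i, mem_univ _, mem_filter.2 ⟨hx.1, hi⟩⟩)
  refine (card_le_card hsub).trans ((card_union_le _ _).trans (add_le_add ?_ ?_))
  · refine card_le_card_of_injOn (fun x => x + y (w - v)) ?_ fun x _ z _ h => add_right_cancel h
    intro x hx
    simp only [coe_filter, Set.mem_ofPred_eq, mem_boxSolutions] at hx ⊢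
    refine ⟨⟨fun i => ?_, ?_⟩, ?_⟩
    · have h1 := hx.2.2 i
      have h2 := hx.1.1 i
      have h3 := abs_le.1 (hY (w - v) i)
      simp only [hD, mem_union, mem_Icc, not_or, not_and, not_le] at h1
      rw [Pi.add_apply]
      omega
    · simp_rw [Pi.add_apply, mul_add, sum_add_distrib, hx.1.2, hy2, add_zero]
    · funext i
      rw [Pi.add_apply, Int.cast_add, hy1, congrFun hx.2.1 i, Pi.sub_apply, add_sub_cancel]
  · refine (card_biUnion_le_card_mul _ _ (2 * Y * n ^ (d - 1)) fun i _ => ?_).trans ?_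
    · refine (card_boxSolutions_filter_mem_le (by omega) ha n i D).trans ?_
      exact Nat.mul_le_mul_right _ hDcard
    · rw [card_univ, Fintype.card_fin]
      exact le_of_eq (by ring)

open Finset in
theorem exists_mul_pow_le_card_boxSolutions {d : ℕ} (hd : 1 ≤ d) {a : Fin (d + 1) → ℤ}
    (ha : a 0 ≠ 0) {x₀ : Fin (d + 1) → ℤ} (hpos : ∀ i, 0 < x₀ i) (hx₀ : ∑ i, a i * x₀ i = 0)
    (K : ℕ) : ∃ N₀ : ℕ, ∀ n, N₀ ≤ n → K * n ^ (d - 1) ≤ #(boxSolutions a n) := by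
  obtain ⟨C, hC, h⟩ := exists_pow_le_card_boxSolutions ha hpos hx₀
  refine ⟨C * (K * (3 * C) ^ (d - 1) + 2), fun n hn => ?_⟩
  obtain ⟨q, hq⟩ : ∃ q, n / C = q + 1 := by
    have : K * (3 * C) ^ (d - 1) + 2 ≤ n / C := (Nat.le_div_iff_mul_le hC).2 (by rwa [mul_comm])
    exact ⟨n / C - 1, by omega⟩
  have hqK : K * (3 * C) ^ (d - 1) + 1 ≤ q := by
    have : K * (3 * C) ^ (d - 1) + 2 ≤ n / C := (Nat.le_div_iff_mul_le hC).2 (by rwa [mul_comm])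
    omega
  have h1 : C * (q + 1) ≤ n := hq ▸ Nat.mul_div_le n C
  have h2 : n ≤ 3 * C * q := by
    have : n < C * (n / C + 1) := Nat.lt_mul_div_succ n hC
    rw [hq] at this
    nlinarith [Nat.mul_le_mul_left C (show 1 ≤ q by omega)]
  calc K * n ^ (d - 1) ≤ K * (3 * C * q) ^ (d - 1) := by gcongr
    _ = K * (3 * C) ^ (d - 1) * q ^ (d - 1) := by rw [mul_pow, mul_assoc]
    _ ≤ q * q ^ (d - 1) := Nat.mul_le_mul_right _ (by omega)
    _ = q ^ d := by rw [← pow_succ', Nat.sub_add_cancel hd]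
    _ ≤ _ := h q n h1

open Finset in
theorem eventually_card_monochromatic_le {p d r : ℕ} [Fact p.Prime] (hd : 1 ≤ d)
    {a : Fin (d + 1) → ℤ} (ha : ∀ i, a i ≠ 0) (hap : (a 0 : ZMod p) ≠ 0)
    {x₀ : Fin (d + 1) → ℤ} (hpos : ∀ i, 0 < x₀ i) (hx₀ : ∑ i, a i * x₀ i = 0)
    (c : ZMod p → Fin r)
    (hc : r ^ d * #{x : Fin (d + 1) → ZMod p | (∑ i, (a i : ZMod p) * x i = 0) ∧
      ∀ i j, c (x i) = c (x j)} < #{x : Fin (d + 1) → ZMod p | ∑ i, (a i : ZMod p) * x i = 0}) :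
    ∃ δ : ℝ, 0 < δ ∧ ∃ N₀ : ℕ, ∀ n : ℕ, N₀ ≤ n →
      (r : ℝ) ^ d * #{x ∈ boxSolutions a n | ∀ i j, c (x i) = c (x j)} ≤
        (1 - δ) * #(boxSolutions a n) := by
  obtain ⟨B, hB⟩ := exists_card_residue_le hd ha hap
  set S : Finset (Fin (d + 1) → ZMod p) := {x | ∑ i, (a i : ZMod p) * x i = 0} with hS
  set Q : Finset (Fin (d + 1) → ZMod p) := {x | (∑ i, (a i : ZMod p) * x i = 0) ∧
      ∀ i j, c (x i) = c (x j)} with hQ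
  obtain ⟨N₀, hN₀⟩ := exists_mul_pow_le_card_boxSolutions hd (ha 0) hpos hx₀ (4 * #S ^ 2 * B)
  have hs : (0 : ℝ) < #S := by exact_mod_cast (Nat.zero_le _).trans_lt hc
  refine ⟨1 / (2 * #S), by positivity, N₀, fun n hn => ?_⟩
  set F : (Fin (d + 1) → ZMod p) → Finset (Fin (d + 1) → ℤ) := fun v =>
    {x ∈ boxSolutions a n | (fun i => (x i : ZMod p)) = v} with hF
  have hres : ∀ x ∈ boxSolutions a n, ∑ i, (a i : ZMod p) * (x i : ZMod p) = 0 := by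
    intro x hx
    exact_mod_cast congrArg (Int.cast (R := ZMod p)) (mem_boxSolutions.1 hx).2
  have htot : #(boxSolutions a n) = ∑ v ∈ S, #(F v) :=
    card_eq_sum_card_fiberwise fun x hx => by simpa [hS] using hres x hx
  have hmono : #{x ∈ boxSolutions a n | ∀ i j, c (x i) = c (x j)} ≤ ∑ v ∈ Q, #(F v) := by
    rw [card_eq_sum_card_fiberwise (f := fun x i => (x i : ZMod p)) (t := Q)]
    · exact sum_le_sum fun v _ => card_le_card (filter_subset_filter _ (filter_subset _ _))
    · intro x hx
      simp only [coe_filter, Set.mem_ofPred_eq] at hx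
      simpa [hQ] using ⟨hres x hx.1, hx.2⟩
  have h0 : ∑ i, (a i : ZMod p) * (0 : Fin (d + 1) → ZMod p) i = 0 := by simp
  have hup : ∑ v ∈ Q, #(F v) ≤ #Q * (#(F 0) + B * n ^ (d - 1)) := by
    rw [← smul_eq_mul]
    refine sum_le_card_nsmul _ _ _ fun v hv => hB v 0 ?_ h0 n
    exact (mem_filter.1 hv).2.1
  have hlow : #S * #(F 0) ≤ #(boxSolutions a n) + #S * (B * n ^ (d - 1)) := by
    rw [htot, ← smul_eq_mul, ← smul_eq_mul, ← sum_const, ← sum_const, ← sum_add_distrib]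
    exact sum_le_sum fun v hv => hB 0 v h0 (mem_filter.1 hv).2 n
  have hbig := hN₀ n hn
  have hmono' : (#{x ∈ boxSolutions a n | ∀ i j, c (x i) = c (x j)} : ℝ) ≤
      #Q * (#(F 0) + B * n ^ (d - 1)) := by exact_mod_cast hmono.trans hup
  have hlow' : (#S : ℝ) * #(F 0) ≤ #(boxSolutions a n) + #S * (B * n ^ (d - 1)) := by
    exact_mod_cast hlow
  have hbig' : 4 * (#S : ℝ) ^ 2 * B * n ^ (d - 1) ≤ #(boxSolutions a n) := by exact_mod_cast hbig
  have hc' : (r : ℝ) ^ d * #Q + 1 ≤ #S := by exact_mod_cast hc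
  set T : ℝ := (#(boxSolutions a n) : ℝ)
  set E : ℝ := (B : ℝ) * n ^ (d - 1) with hE
  set s : ℝ := (#S : ℝ)
  set f : ℝ := (#(F 0) : ℝ)
  have hE0 : 0 ≤ E := by positivity
  have hf0 : 0 ≤ f := by positivity
  have hs1 : 1 ≤ s := le_trans (by linarith [show 0 ≤ (r : ℝ) ^ d * #Q by positivity]) hc'
  have h1 : (r : ℝ) ^ d * #{x ∈ boxSolutions a n | ∀ i j, c (x i) = c (x j)} ≤
      (s - 1) * (f + E) := by
    calc _ ≤ (r : ℝ) ^ d * (#Q * (f + E)) := by gcongr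
      _ = (r : ℝ) ^ d * #Q * (f + E) := by ring
      _ ≤ _ := mul_le_mul_of_nonneg_right (by linarith) (by positivity)
  have h2 : s * ((s - 1) * (f + E)) ≤ (s - 1) * (T + 2 * s * E) := by
    nlinarith [mul_le_mul_of_nonneg_left hlow' (sub_nonneg.2 hs1)]
  have h3 : s * ((1 - 1 / (2 * s)) * T) = s * T - T / 2 := by
    field_simp
  refine h1.trans (le_of_mul_le_mul_left (h2.trans ?_) hs)
  rw [h3]
  have h4 : 4 * s ^ 2 * E ≤ T := by
    rw [hE, ← mul_assoc]
    exact hbig'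
  nlinarith [mul_nonneg hs.le hE0]

/-- Every linear equation with `k = 2m` terms (`m ≥ 2`), nonzero integer coefficients,
and no canceling partition (no fixed-point-free involution `σ` of the indices with
`a i + a (σ i) = 0`) is `r`-uncommon over the integers for every `r ≥ 2`. -/
theorem no_canceling_partition_r_uncommon
    (m : ℕ) (hm : 2 ≤ m) (k : ℕ) (hk : k = 2 * m)
    (a : Fin k → ℤ) (ha : ∀ i, a i ≠ 0)
    (hnc : ¬ ∃ σ : Equiv.Perm (Fin k),
      (∀ i, σ i ≠ i) ∧ (∀ i, σ (σ i) = i) ∧ (∀ i, a i + a (σ i) = 0))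
    (r : ℕ) (hr : 2 ≤ r) :
    ∃ δ : ℝ, 0 < δ ∧ ∃ N₀ : ℕ, ∀ n : ℕ, N₀ ≤ n →
      ∃ c : ℤ → Fin r,
        (r : ℝ) ^ (k - 1) *
          (((Fintype.piFinset fun _ : Fin k => Finset.Icc (1 : ℤ) n).filter
            (fun x => (∑ i, a i * x i = 0) ∧ ∀ i j, c (x i) = c (x j))).card : ℝ)
        ≤ (1 - δ) *
          (((Fintype.piFinset fun _ : Fin k => Finset.Icc (1 : ℤ) n).filter
            (fun x => ∑ i, a i * x i = 0)).card : ℝ) := by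
  obtain ⟨d, rfl⟩ : ∃ d, k = d + 1 := ⟨k - 1, by omega⟩
  by_cases hsol : ∃ x₀ : Fin (d + 1) → ℤ, (∀ i, 0 < x₀ i) ∧ ∑ i, a i * x₀ i = 0
  · obtain ⟨x₀, hpos, hx₀⟩ := hsol
    obtain ⟨p, hp, hap, _, c, hc⟩ :=
      exists_prime_coloring (by omega) (hk ▸ even_two_mul m) ha hnc hr
    have : Fact p.Prime := ⟨hp⟩
    obtain ⟨δ, hδ, N₀, h⟩ :=
      eventually_card_monochromatic_le (by omega) ha (hap 0) hpos hx₀ c hc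
    refine ⟨δ, hδ, N₀, fun n hn => ⟨fun z => c z, ?_⟩⟩
    have := h n hn
    rwa [boxSolutions, Finset.filter_filter] at this
  · refine ⟨1, one_pos, 0, fun n _ => ⟨fun _ => ⟨0, by omega⟩, ?_⟩⟩
    rw [Finset.filter_eq_empty_iff.2]
    · simp
    · rintro x hx ⟨h, -⟩
      exact hsol ⟨x, fun i => (Finset.mem_Icc.1 (Fintype.mem_piFinset.1 hx i)).1, h⟩
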